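/- Suppose max(1 − 1/α, 0) < β < 1, n P(H > M_n)^{2−β} (log M_n)² → 0, and the tail of H is second order regularly varying with auxiliary function A regularly varying of index ρα, where ρ < −(1−β)/β. Then for any sequence (v_n) with v_n ∼ n P(H > γM_n)^β, one has √v_n = o( A(b(n/v_n))^{−1} ), i.e. √v_n · A(b(n/v_n)) → 0 as n → ∞. -/

import Mathlib

open MeasureTheory ProbabilityTheory Filter Topology Set Asymptotics

noncomputable section

variable {Ω : Type*} [MeasureSpace Ω]

/-- The `k`-th largest order statistic (1-indexed) of the finite sample `f`,
so `orderStat f 1 ≥ orderStat f 2 ≥ … ≥ orderStat f n`. -/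
def orderStat {n : ℕ} (f : Fin n → ℝ) (k : ℕ) : ℝ :=
  if h : n - k < n then f (Tuple.sort f ⟨n - k, h⟩) else 0

/-- The Hill statistic `h(k,n) = (1/k) ∑_{i=1}^k log (X_{(i)} / X_{(k)})`. -/
def hill {n : ℕ} (f : Fin n → ℝ) (k : ℕ) : ℝ :=
  (k : ℝ)⁻¹ * ∑ i ∈ Finset.Icc 1 k, Real.log (orderStat f i / orderStat f k)

/-- Tail probability `x ↦ P(Z > x)`. -/
def tailP (Z : Ω → ℝ) (x : ℝ) : ℝ := (ℙ {ω | Z ω > x}).toReal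

/-- `b(y) := inf {x : 1/P(H > x) ≥ y}`. -/
def bq (Z : Ω → ℝ) (y : ℝ) : ℝ := sInf {x : ℝ | 1 / tailP Z x ≥ y}

/-- `l(x) := x^α P(H > x)`. -/
def ell (α : ℝ) (Z : Ω → ℝ) (x : ℝ) : ℝ := x ^ α * tailP Z x

/-- The tail of `H` is regularly varying with index `-α`. -/
def RegVarTail (H0 : Ω → ℝ) (α : ℝ) : Prop :=
  ∀ x : ℝ, 0 < x → Tendsto (fun t => tailP H0 (t * x) / tailP H0 t) atTop (𝓝 (x ^ (-α)))

/-- A function is regularly varying (at infinity) with index `σ`. -/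
def RegVarFun (A : ℝ → ℝ) (σ : ℝ) : Prop :=
  ∀ x : ℝ, 0 < x → Tendsto (fun t => A (t * x) / A t) atTop (𝓝 (x ^ σ))

/-- Second order regular variation of the tail of `H`, with auxiliary function `A`:
`lim_{t→∞} [(P(H > tx)/P(H > t) - x^{-α})/A(t)] = x^{-α} (x^{ρα} - 1)/(ρ/α)` for all `x > 0`. -/
def SecondOrderRVTail (H0 : Ω → ℝ) (α ρ : ℝ) (A : ℝ → ℝ) : Prop :=
  ∀ x : ℝ, 0 < x →
    Tendsto (fun t => (tailP H0 (t * x) / tailP H0 t - x ^ (-α)) / A t) atTop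
      (𝓝 (x ^ (-α) * (x ^ (ρ * α) - 1) / (ρ / α)))

lemma tailP_nonneg {Ω : Type*} [MeasureSpace Ω] (Z : Ω → ℝ) (x : ℝ) : 0 ≤ tailP Z x :=
  ENNReal.toReal_nonneg

lemma tailP_le_one {Ω : Type*} [MeasureSpace Ω] [IsProbabilityMeasure (ℙ : Measure Ω)]
    (Z : Ω → ℝ) (x : ℝ) : tailP Z x ≤ 1 :=
  ENNReal.toReal_le_of_le_ofReal zero_le_one (by simpa using prob_le_one)

lemma tailP_antitone {Ω : Type*} [MeasureSpace Ω] [IsProbabilityMeasure (ℙ : Measure Ω)]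
    (Z : Ω → ℝ) : Antitone (tailP Z) := fun _ y hxy =>
  ENNReal.toReal_mono (measure_ne_top _ _)
    (measure_mono fun _ (hω : y < _) => lt_of_le_of_lt hxy hω)

lemma RegVarTail.tailP_pos {Ω : Type*} [MeasureSpace Ω] [IsProbabilityMeasure (ℙ : Measure Ω)]
    {Z : Ω → ℝ} {α : ℝ} (h : RegVarTail Z α) (x : ℝ) : 0 < tailP Z x := by
  have h1 := (h 1 one_pos).eventually_ne (by simp : (1 : ℝ) ^ (-α) ≠ 0)
  obtain ⟨t, ht, hxt⟩ := (h1.and (eventually_ge_atTop x)).exists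
  have ht0 : tailP Z t ≠ 0 := fun h0 => ht (by simp [h0])
  exact ((tailP_nonneg Z t).lt_of_ne ht0.symm).trans_le (tailP_antitone Z hxt)

/-- One-sided Potter bound: a locally bounded function that scales like `2 ^ σ₀` under doubling
is dominated by every power `t ^ σ` with `σ₀ < σ`. -/
lemma exists_eventually_le_mul_rpow {f : ℝ → ℝ} {σ₀ σ : ℝ} (hσ : σ₀ < σ)
    (hpos : ∀ᶠ t in atTop, 0 < f t)
    (hbdd : ∀ᶠ a in atTop, BddAbove (f '' Icc a (2 * a)))
    (hlim : Tendsto (fun t => f (t * 2) / f t) atTop (𝓝 (2 ^ σ₀))) :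
    ∃ C > 0, ∀ᶠ t in atTop, f t ≤ C * t ^ σ := by
  have hlt : (2 : ℝ) ^ σ₀ < 2 ^ σ := Real.rpow_lt_rpow_of_exponent_lt one_lt_two hσ
  obtain ⟨a₀, ha₀⟩ := eventually_atTop.1 ((hlim.eventually_lt_const hlt).and hpos)
  obtain ⟨a, ⟨K, hK⟩, haa, ha1⟩ :=
    (hbdd.and ((eventually_ge_atTop a₀).and (eventually_ge_atTop 1))).exists
  have hcont : ContinuousOn (fun t : ℝ => t ^ (-σ)) (Icc a (2 * a)) := fun t ht =>
    (Real.continuousAt_rpow_const t (-σ) (Or.inl (by linarith [ht.1]))).continuousWithinAt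
  obtain ⟨B, hB⟩ := (isCompact_Icc.image_of_continuousOn hcont).bddAbove
  have hbase : ∀ t ∈ Icc a (2 * a), f t ≤ (K * B) * t ^ σ := by
    intro t ht
    have htpos : 0 < t := by linarith [ht.1]
    have h1 : f t ≤ K := hK (mem_image_of_mem f ht)
    have h2 : t ^ (-σ) ≤ B := hB (mem_image_of_mem (fun t : ℝ => t ^ (-σ)) ht)
    have h3 : 0 < f t := (ha₀ t (haa.trans ht.1)).2
    have h4 : 0 < t ^ σ := Real.rpow_pos_of_pos htpos σ
    rw [Real.rpow_neg htpos.le] at h2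
    calc f t ≤ K := h1
      _ = K * (t ^ σ)⁻¹ * t ^ σ := by field_simp
      _ ≤ K * B * t ^ σ := by
          have : 0 ≤ K := h3.le.trans h1
          gcongr
  have hC : 0 < K * B := by
    have h := hbase a ⟨le_rfl, by linarith⟩
    exact pos_of_mul_pos_left ((ha₀ a haa).2.trans_le h)
      (Real.rpow_nonneg (by linarith) σ)
  have hall : ∀ k : ℕ, ∀ t, a ≤ t → t ≤ 2 ^ k * (2 * a) → f t ≤ (K * B) * t ^ σ := by
    intro k
    induction k with
    | zero => exact fun t h1 h2 => hbase t ⟨h1, by simpa using h2⟩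
    | succ k ih =>
      intro t h1 h2
      rcases le_total t (2 * a) with h | h
      · exact hbase t ⟨h1, h⟩
      have hs := ih (t / 2) (by linarith) (by rw [pow_succ] at h2; linarith)
      obtain ⟨hr, hp⟩ := ha₀ (t / 2) (by linarith)
      rw [div_lt_iff₀ hp, div_mul_cancel₀ t two_ne_zero] at hr
      calc f t ≤ 2 ^ σ * f (t / 2) := hr.le
        _ ≤ 2 ^ σ * (K * B * (t / 2) ^ σ) := by gcongr
        _ = K * B * t ^ σ := by
          rw [Real.div_rpow (by linarith) zero_le_two]
          field_simp
  refine ⟨K * B, hC, eventually_atTop.2 ⟨a, fun t ht => ?_⟩⟩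
  obtain ⟨k, hk⟩ := pow_unbounded_of_one_lt t one_lt_two
  exact hall k t ht (hk.le.trans (le_mul_of_one_le_right (by positivity) (by linarith)))

lemma RegVarTail.tendsto_tailP {Ω : Type*} [MeasureSpace Ω] [IsProbabilityMeasure (ℙ : Measure Ω)]
    {Z : Ω → ℝ} {α : ℝ} (h : RegVarTail Z α) (hα : 0 < α) :
    Tendsto (tailP Z) atTop (𝓝 0) := by
  obtain ⟨C, -, hC⟩ := exists_eventually_le_mul_rpow (σ := -(α / 2)) (by linarith)
    (Eventually.of_forall h.tailP_pos)
    (Eventually.of_forall fun a => ⟨1, by rintro _ ⟨t, -, rfl⟩; exact tailP_le_one Z t⟩)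
    (h 2 two_pos)
  refine squeeze_zero' (Eventually.of_forall (tailP_nonneg Z)) hC ?_
  simpa using (tendsto_rpow_neg_atTop (half_pos hα)).const_mul C

/-- The quantile function of a regularly varying tail of index `-α` eventually dominates
`y ^ (1 / μ)`, up to a constant, whenever `α < μ`. -/
lemma RegVarTail.exists_eventually_le_bq {Ω : Type*} [MeasureSpace Ω]
    [IsProbabilityMeasure (ℙ : Measure Ω)] {Z : Ω → ℝ} {α μ : ℝ} (h : RegVarTail Z α)
    (hα : 0 < α) (hμ : α < μ) :
    ∃ c > 0, ∀ᶠ y in atTop, (c * y) ^ μ⁻¹ ≤ bq Z y := by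
  have hμ0 : 0 < μ := hα.trans hμ
  obtain ⟨C, hC0, hC⟩ := exists_eventually_le_mul_rpow (f := fun t => (tailP Z t)⁻¹) hμ
    (Eventually.of_forall fun t => inv_pos.2 (h.tailP_pos t))
    (Eventually.of_forall fun a => ⟨(tailP Z (2 * a))⁻¹, by
      rintro _ ⟨t, ht, rfl⟩
      exact inv_anti₀ (h.tailP_pos _) (tailP_antitone Z ht.2)⟩)
    (by
      have := (h 2 two_pos).inv₀ (by positivity)
      rw [Real.rpow_neg zero_le_two, inv_inv] at this
      refine this.congr fun t => ?_
      rw [inv_div, inv_div_inv])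
  refine ⟨(2 * C)⁻¹, by positivity, ?_⟩
  have hz : Tendsto (fun y : ℝ => ((2 * C)⁻¹ * y) ^ μ⁻¹) atTop atTop :=
    (tendsto_rpow_atTop (inv_pos.2 hμ0)).comp
      (tendsto_id.const_mul_atTop (by positivity))
  filter_upwards [hz.eventually hC, eventually_gt_atTop 0] with y hy hy0
  have hlow : 1 / tailP Z (((2 * C)⁻¹ * y) ^ μ⁻¹) < y := by
    rw [Real.rpow_inv_rpow (by positivity) hμ0.ne'] at hy
    calc 1 / tailP Z (((2 * C)⁻¹ * y) ^ μ⁻¹) ≤ C * ((2 * C)⁻¹ * y) := by rwa [one_div]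
      _ = y / 2 := by field_simp
      _ < y := half_lt_self hy0
  refine le_csInf ?_ fun x hx => ?_
  · have h0 : Tendsto (fun x => 1 / tailP Z x) atTop atTop := by
      simp_rw [one_div]
      exact (tendsto_nhdsWithin_iff.2
        ⟨h.tendsto_tailP hα, Eventually.of_forall h.tailP_pos⟩).inv_tendsto_nhdsGT_zero
    exact (h0.eventually_ge_atTop y).exists
  · by_contra! hlt
    have : 1 / tailP Z x ≤ 1 / tailP Z (((2 * C)⁻¹ * y) ^ μ⁻¹) :=
      one_div_le_one_div_of_le (h.tailP_pos _) (tailP_antitone Z hlt.le)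
    exact absurd (hx.trans this) (not_le.2 hlow)

lemma SecondOrderRVTail.tendsto_zero {Ω : Type*} [MeasureSpace Ω] {Z : Ω → ℝ} {α ρ : ℝ}
    {A : ℝ → ℝ} (h : SecondOrderRVTail Z α ρ A) (hreg : RegVarTail Z α) (hα : 0 < α)
    (hρ : ρ < 0) : Tendsto A atTop (𝓝 0) := by
  set L : ℝ := 2 ^ (-α) * (2 ^ (ρ * α) - 1) / (ρ / α) with hL
  have hL0 : L ≠ 0 := by
    have h1 : (2 : ℝ) ^ (ρ * α) < 1 :=
      Real.rpow_lt_one_of_one_lt_of_neg one_lt_two (mul_neg_of_neg_of_pos hρ hα)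
    exact div_ne_zero (mul_ne_zero (by positivity) (by linarith))
      (div_ne_zero hρ.ne hα.ne')
  have hq := (hreg 2 two_pos).sub_const ((2 : ℝ) ^ (-α))
  have hlim := hq.div (h 2 two_pos) hL0
  rw [sub_self, zero_div] at hlim
  refine hlim.congr' ?_
  filter_upwards [(h 2 two_pos).eventually_ne hL0] with t ht
  have hne := div_ne_zero_iff.1 ht
  exact div_div_cancel₀ hne.1

/-- Along the quantile function, a second order auxiliary function of index `ρ * α` decays faster
than `y ^ (-κ)` for every `κ < -ρ`, up to a constant. -/
lemma SecondOrderRVTail.exists_eventually_comp_bq_le {Ω : Type*} [MeasureSpace Ω]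
    [IsProbabilityMeasure (ℙ : Measure Ω)] {Z : Ω → ℝ} {α ρ κ : ℝ} {A : ℝ → ℝ}
    (h : SecondOrderRVTail Z α ρ A) (hreg : RegVarTail Z α) (hα : 0 < α) (hρ : ρ < 0)
    (hApos : ∀ t, 0 < t → 0 < A t) (hAreg : RegVarFun A (ρ * α)) (hκ : 0 < κ) (hκρ : κ < -ρ) :
    ∃ C > 0, ∀ᶠ y in atTop, 0 ≤ A (bq Z y) ∧ A (bq Z y) ≤ C * y ^ (-κ) := by
  obtain ⟨μ, hμ, hμκ⟩ : ∃ μ, α < μ ∧ μ < -ρ * α / κ := exists_between <| by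
    rw [lt_div_iff₀ hκ, mul_comm]
    exact mul_lt_mul_of_pos_right hκρ hα
  have hμ0 : 0 < μ := hα.trans hμ
  rw [lt_div_iff₀ hκ] at hμκ
  obtain ⟨a, ha⟩ := eventually_atTop.1 ((h.tendsto_zero hreg hα hρ).eventually_le_const one_pos)
  obtain ⟨C, hC0, hC⟩ := exists_eventually_le_mul_rpow (f := A) (σ := -(μ * κ))
    (by linarith) ((eventually_gt_atTop 0).mono hApos)
    ((eventually_ge_atTop a).mono fun b hb =>
      ⟨1, by rintro _ ⟨t, ht, rfl⟩; exact ha t (hb.trans ht.1)⟩) (hAreg 2 two_pos)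
  obtain ⟨c, hc, hb⟩ := hreg.exists_eventually_le_bq hα hμ
  have hz : Tendsto (fun y : ℝ => (c * y) ^ μ⁻¹) atTop atTop :=
    (tendsto_rpow_atTop (inv_pos.2 hμ0)).comp (tendsto_id.const_mul_atTop hc)
  have hbtop : Tendsto (bq Z) atTop atTop := tendsto_atTop_mono' _ hb hz
  refine ⟨C * c ^ (-κ), by positivity, ?_⟩
  filter_upwards [hb, hbtop.eventually hC, hbtop.eventually_gt_atTop 0, eventually_gt_atTop 0]
    with y h1 h2 h3 hy
  refine ⟨(hApos _ h3).le, h2.trans ?_⟩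
  have h4 : bq Z y ^ (-(μ * κ)) ≤ ((c * y) ^ μ⁻¹) ^ (-(μ * κ)) :=
    Real.rpow_le_rpow_of_nonpos (by positivity) h1 (by nlinarith [mul_pos hμ0 hκ])
  rw [← Real.rpow_mul (by positivity), mul_neg, inv_mul_cancel_left₀ hμ0.ne',
    Real.mul_rpow hc.le hy.le] at h4
  rw [mul_assoc]
  gcongr

/-- If `max(1 - 1/α, 0) < β < 1`, Assumption C holds, and the tail of `H` is second order
regularly varying with auxiliary function `A` regularly varying of index `ρα` where
`ρ < -(1-β)/β`, then for any `v_n ∼ n P(H > γ M_n)^β` one has `√v_n A(b(n/v_n)) → 0`. -/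
theorem sqrt_vn_mul_A_b_tendsto_zero
    {Ω : Type*} [MeasureSpace Ω] [IsProbabilityMeasure (ℙ : Measure Ω)]
    (H0 : Ω → ℝ) (hH0meas : Measurable H0) (hH0nn : ∀ ω, 0 ≤ H0 ω)
    (α β γ : ℝ) (hα : 0 < α) (hγ : γ ∈ Ioo (0:ℝ) 1)
    (hβl : max (1 - 1 / α) 0 < β) (hβu : β < 1)
    (hreg : RegVarTail H0 α)
    (M : ℕ → ℝ) (hMpos : ∀ n, 0 < M n) (hMtop : Tendsto M atTop atTop)
    (hC : Tendsto (fun n : ℕ => (n : ℝ) * tailP H0 (M n) ^ (2 - β) * Real.log (M n) ^ 2)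
      atTop (𝓝 0))
    (ρ : ℝ) (hρ : ρ < 0) (hρβ : ρ < -((1 - β) / β))
    (A : ℝ → ℝ) (hApos : ∀ t, 0 < t → 0 < A t) (hAreg : RegVarFun A (ρ * α))
    (hsnd : SecondOrderRVTail H0 α ρ A) :
    ∀ v : ℕ → ℝ,
      Tendsto (fun n : ℕ => v n / ((n : ℝ) * tailP H0 (γ * M n) ^ β)) atTop (𝓝 1) →
      Tendsto (fun n : ℕ => Real.sqrt (v n) * A (bq H0 ((n : ℝ) / v n))) atTop (𝓝 0) := by
  intro v hv
  have hβ : 0 < β := (le_max_right _ _).trans_lt hβl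
  obtain ⟨κ, hκl, hκρ⟩ : ∃ κ, (1 - β) / β < κ ∧ κ < -ρ := exists_between (by linarith)
  have hκ : 0 < κ := (div_pos (by linarith) hβ).trans hκl
  rw [div_lt_iff₀ hβ] at hκl
  obtain ⟨C, hC0, hAb⟩ :=
    hsnd.exists_eventually_comp_bq_le hreg hα hρ hApos hAreg hκ hκρ
  have hp0 : ∀ n, 0 < tailP H0 (M n) := fun n => hreg.tailP_pos _
  have hp : Tendsto (fun n => tailP H0 (M n)) atTop (𝓝 0) :=
    (hreg.tendsto_tailP hα).comp hMtop
  obtain ⟨D, hD⟩ := exists_gt (γ ^ (-α))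
  have hD0 : 0 < D := (Real.rpow_pos_of_pos hγ.1 _).trans hD
  -- Eventual bounds on `v n` and on `n / v n` in terms of `P(H > M n)`.
  have hbounds : ∀ᶠ n : ℕ in atTop,
      √(v n) ≤ √(2 * D ^ β) * tailP H0 (M n) ^ (-(1 - β)) ∧
      (2 * D ^ β * tailP H0 (M n) ^ β)⁻¹ ≤ n / v n := by
    have hratio := ((hreg γ hγ.1).comp hMtop).eventually_le_const hD
    filter_upwards [hratio, hv.eventually_le_const one_lt_two,
      hv.eventually_const_le (one_half_lt_one (α := ℝ)),
      hC.eventually_le_const one_pos, hMtop.eventually_ge_atTop (Real.exp 1),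
      eventually_gt_atTop 0] with n h1 h2 h3 h4 h5 hn
    have hn0 : (0 : ℝ) < n := Nat.cast_pos.2 hn
    have hq := hreg.tailP_pos (γ * M n)
    have hpn := hp0 n
    simp only [Function.comp_apply] at h1
    rw [div_le_iff₀ hpn, mul_comm (M n)] at h1
    rw [div_le_iff₀ (by positivity)] at h2
    rw [le_div_iff₀ (by positivity)] at h3
    have hv0 : 0 < v n := lt_of_lt_of_le (by positivity) h3
    have hqβ : tailP H0 (γ * M n) ^ β ≤ D ^ β * tailP H0 (M n) ^ β := by
      rw [← Real.mul_rpow hD0.le hpn.le]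
      gcongr
    have hvle : v n ≤ n * (2 * D ^ β * tailP H0 (M n) ^ β) := by
      calc v n ≤ 2 * (n * tailP H0 (γ * M n) ^ β) := h2
        _ ≤ 2 * (n * (D ^ β * tailP H0 (M n) ^ β)) := by gcongr
        _ = _ := by ring
    constructor
    · have hlog : 1 ≤ Real.log (M n) := by
        rwa [Real.le_log_iff_exp_le (hMpos n)]
      have h6 : n * tailP H0 (M n) ^ (2 - β) ≤ 1 :=
        (le_mul_of_one_le_right (by positivity) (one_le_pow₀ hlog)).trans h4
      have h7 : tailP H0 (M n) ^ β =
          tailP H0 (M n) ^ (2 - β) * (tailP H0 (M n) ^ (-(1 - β))) ^ 2 := by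
        rw [← Real.rpow_natCast, ← Real.rpow_mul hpn.le, ← Real.rpow_add hpn]
        congr 1
        push_cast
        ring
      have h8 : v n ≤ 2 * D ^ β * (tailP H0 (M n) ^ (-(1 - β))) ^ 2 := by
        rw [h7] at hvle
        calc v n ≤ _ := hvle
          _ = (n * tailP H0 (M n) ^ (2 - β)) *
              (2 * D ^ β * (tailP H0 (M n) ^ (-(1 - β))) ^ 2) := by ring
          _ ≤ _ := mul_le_of_le_one_left (by positivity) h6
      calc √(v n) ≤ √(2 * D ^ β * (tailP H0 (M n) ^ (-(1 - β))) ^ 2) := Real.sqrt_le_sqrt h8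
        _ = _ := by rw [Real.sqrt_mul (by positivity), Real.sqrt_sq (by positivity)]
    · rw [le_div_iff₀ hv0, inv_mul_le_iff₀ (by positivity), mul_comm]
      exact hvle
  have hpβ : Tendsto (fun n => 2 * D ^ β * tailP H0 (M n) ^ β) atTop (𝓝 0) := by
    simpa [Real.zero_rpow hβ.ne'] using
      (hp.rpow_const (Or.inr hβ.le)).const_mul (2 * D ^ β)
  have hytop : Tendsto (fun n : ℕ => (n : ℝ) / v n) atTop atTop :=
    tendsto_atTop_mono' _ (hbounds.mono fun _ h => h.2)
      (tendsto_nhdsWithin_iff.2 ⟨hpβ, Eventually.of_forall fun n => by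
        have := hp0 n
        exact mem_Ioi.2 (by positivity)⟩).inv_tendsto_nhdsGT_zero
  have hexp : 0 < κ * β - (1 - β) := by linarith
  have hlim : Tendsto (fun n => √(2 * D ^ β) * C * (2 * D ^ β) ^ κ *
      tailP H0 (M n) ^ (κ * β - (1 - β))) atTop (𝓝 0) := by
    simpa [Real.zero_rpow hexp.ne'] using
      (hp.rpow_const (Or.inr hexp.le)).const_mul (√(2 * D ^ β) * C * (2 * D ^ β) ^ κ)
  refine squeeze_zero' ?_ ?_ hlim
  · filter_upwards [hytop.eventually hAb] with n h
    exact mul_nonneg (Real.sqrt_nonneg _) h.1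
  · filter_upwards [hytop.eventually hAb, hbounds] with n ⟨hA0, hA⟩ ⟨h1, h2⟩
    have hpn := hp0 n
    have h3 : ((n : ℝ) / v n) ^ (-κ) ≤ (2 * D ^ β) ^ κ * tailP H0 (M n) ^ (κ * β) := by
      calc ((n : ℝ) / v n) ^ (-κ) ≤ ((2 * D ^ β * tailP H0 (M n) ^ β)⁻¹) ^ (-κ) :=
            Real.rpow_le_rpow_of_nonpos (by positivity) h2 (by linarith)
        _ = (2 * D ^ β * tailP H0 (M n) ^ β) ^ κ := by
            rw [Real.inv_rpow (by positivity), Real.rpow_neg (by positivity), inv_inv]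
        _ = _ := by
            rw [Real.mul_rpow (by positivity) (by positivity), ← Real.rpow_mul hpn.le,
              mul_comm β κ]
    calc √(v n) * A (bq H0 (n / v n))
        ≤ (√(2 * D ^ β) * tailP H0 (M n) ^ (-(1 - β))) *
          (C * ((2 * D ^ β) ^ κ * tailP H0 (M n) ^ (κ * β))) := by
          gcongr
          exact hA.trans (by gcongr)
      _ = _ := by
          rw [sub_eq_add_neg (κ * β), Real.rpow_add hpn]
          ring
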